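/- arXiv:2504.07636 — 7 statements merged into one kernel-verified Lean document; each statement's English description precedes it below -/
import Mathlib

section
/- Let p > 2, m < 0, n and N be integers with n ≥ -m + 2 and N ≥ 1. Then the block-diagonal direct sum of N copies of Q_p(m,n) (a symmetric integer matrix of size Nnp) does not embed in ⟨-1⟩^{Nnp}; that is, there is no Nnp × Nnp integer matrix A with ⊕_N Q_p(m,n) = -Aᵀ·A. -/
open Matrix

/-- The intersection form `Q_p(m,n)`: a symmetric integer matrix of size `n * p`,
with rows and columns indexed by pairs `(k, i)`, `k ∈ {0,…,n-1}` (block index) and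
`i ∈ ℤ/p` (cyclic index, realized as `Fin p` with mod-`p` arithmetic). Entries:
`Q((0,i),(0,i)) = 2m-1`; `Q((0,i),(0,j)) = -m` if `j = i ± 1 (mod p)`;
`Q((k,i),(k,i)) = -2` for `k ≥ 1`; `Q((k,i),(k',i)) = 1` if `|k - k'| = 1`;
all other entries `0`. -/
def Qmat (p n : ℕ) (m : ℤ) : Matrix (Fin n × Fin p) (Fin n × Fin p) ℤ :=
  Matrix.of fun x y =>
    if x.1 = y.1 then
      if (x.1 : ℕ) = 0 then
        if x.2 = y.2 then 2 * m - 1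
        else if ((x.2 : ℕ) + 1) % p = (y.2 : ℕ) ∨ ((y.2 : ℕ) + 1) % p = (x.2 : ℕ) then -m
        else 0
      else if x.2 = y.2 then -2 else 0
    else if x.2 = y.2 ∧ ((x.1 : ℕ) + 1 = (y.1 : ℕ) ∨ (y.1 : ℕ) + 1 = (x.1 : ℕ)) then 1
    else 0

/-- The block-diagonal direct sum of `N` copies of `Q_p(m,n)`, a symmetric integer
matrix of size `N * n * p`. -/
def QmatSum (N p n : ℕ) (m : ℤ) :
    Matrix (Fin N × Fin n × Fin p) (Fin N × Fin n × Fin p) ℤ :=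
  Matrix.of fun x y => if x.1 = y.1 then Qmat p n m x.2 y.2 else 0

lemma qm_split {I : Type*} [Fintype I] [DecidableEq I] (u : I → ℤ) (h : u ⬝ᵥ u ≠ 0) :
    ∃ (i : I) (a : ℤ) (w : I → ℤ), a ≠ 0 ∧ w i = 0 ∧ u = Pi.single i a + w ∧
      u ⬝ᵥ u = a * a + w ⬝ᵥ w := by
  have h1 : ∃ i, u i ≠ 0 := by
    by_contra! hh
    apply h
    simp [dotProduct, hh]
  obtain ⟨i, hi⟩ := h1
  refine ⟨i, u i, u - Pi.single i (u i), hi, by simp, by simp, ?_⟩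
  simp [sub_dotProduct, dotProduct_sub]

lemma qm_norm_two {I : Type*} [Fintype I] [DecidableEq I] (u : I → ℤ) (h : u ⬝ᵥ u = 2) :
    ∃ (i j : I) (a b : ℤ), i ≠ j ∧ (a = 1 ∨ a = -1) ∧ (b = 1 ∨ b = -1) ∧
      u = Pi.single i a + Pi.single j b := by
  have key : ∀ w : I → ℤ, 0 ≤ w ⬝ᵥ w := fun w =>
    Finset.sum_nonneg fun i _ => mul_self_nonneg (w i)
  have sq1 : ∀ a : ℤ, a ≠ 0 → a * a ≤ 2 → a = 1 ∨ a = -1 := by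
    intro a ha h2
    have : a ≤ 1 := by nlinarith
    have : -1 ≤ a := by nlinarith
    omega
  obtain ⟨i, a, w, ha, hwi, hu, hn⟩ := qm_split u (by omega)
  have ha' := sq1 a ha (by have := key w; omega)
  have hw1 : w ⬝ᵥ w = 1 := by rcases ha' with rfl | rfl <;> omega
  obtain ⟨j, b, z, hb, hzj, hw, hn2⟩ := qm_split w (by omega)
  have hb' := sq1 b hb (by have := key z; omega)
  have hz1 : z ⬝ᵥ z = 0 := by rcases hb' with rfl | rfl <;> omega
  have hz : z = 0 := dotProduct_self_eq_zero.1 hz1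
  subst hz
  refine ⟨i, j, a, b, ?_, ha', hb', by rw [hu, hw, add_zero]⟩
  rintro rfl
  rw [hw] at hwi
  simp at hwi
  exact hb hwi

lemma qm_bound {I : Type*} [Fintype I] [DecidableEq I] (u : I → ℤ) (F : ℕ → I) (t : ℕ → ℤ)
    (ht : ∀ k, t k = 1 ∨ t k = -1) (L : ℕ)
    (hF : ∀ k l, k < L → l < L → F k = F l → k = l) :
    ∑ k ∈ Finset.range L, (t k * u (F k)) ^ 2 ≤ u ⬝ᵥ u := by
  have : ∑ k ∈ Finset.range L, (t k * u (F k)) ^ 2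
      = ∑ r ∈ (Finset.range L).image F, u r * u r := by
    rw [Finset.sum_image]
    · refine Finset.sum_congr rfl fun k _ => ?_
      rcases ht k with h | h <;> rw [h] <;> ring
    · intro k hk l hl h
      exact hF k l (by simpa using hk) (by simpa using hl) h
  rw [this]
  exact Finset.sum_le_sum_of_subset_of_nonneg (Finset.subset_univ _)
    fun i _ _ => mul_self_nonneg _

lemma qm_const (f : ℕ → ℤ) (L : ℕ) (h : ∀ k, k < L → f (k + 1) = f k) :
    ∀ k, k ≤ L → f k = f 0 := by
  intro k
  induction k with
  | zero => intro _; rfl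
  | succ k ih => intro hk; rw [h k (by omega), ih (by omega)]

set_option maxHeartbeats 1000000 in
lemma qm_chain {I : Type*} [Fintype I] [DecidableEq I] (n : ℕ) (v : ℕ → I → ℤ)
    (hnorm : ∀ k, 1 ≤ k → k < n → v k ⬝ᵥ v k = 2)
    (hadj : ∀ k, k + 1 < n → v k ⬝ᵥ v (k + 1) = -1)
    (horth : ∀ k l, k + 2 ≤ l → l < n → v k ⬝ᵥ v l = 0) (L : ℕ) (hL : 2 ≤ L) : L < n →
    ∃ (F : ℕ → I) (t : ℕ → ℤ), (∀ k, t k = 1 ∨ t k = -1) ∧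
      (∀ k l, k < L + 1 → l < L + 1 → F k = F l → k = l) ∧
      ∀ k, k < L → v (k + 1) = Pi.single (F k) (t k) - Pi.single (F (k + 1)) (t (k + 1)) := by
  induction L, hL using Nat.le_induction with
  | base =>
    intro hn
    have main : ∃ (i j l : I) (a b c : ℤ), i ≠ j ∧ j ≠ l ∧ i ≠ l ∧ (a = 1 ∨ a = -1) ∧
        (b = 1 ∨ b = -1) ∧ (c = 1 ∨ c = -1) ∧ v 1 = Pi.single i a - Pi.single j b ∧
        v 2 = Pi.single j b - Pi.single l c := by
      obtain ⟨i, j, a, b, hij, ha, hb, h1⟩ := qm_norm_two _ (hnorm 1 (by omega) (by omega))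
      obtain ⟨k, l, c, d, hkl, hc, hd, h2⟩ := qm_norm_two _ (hnorm 2 (by omega) (by omega))
      have h12 := hadj 1 (by omega)
      simp only [Nat.reduceAdd] at h12
      rw [h1, h2] at h12
      simp [Pi.single_apply] at h12
      have opp : ∀ x y : ℤ, (x = 1 ∨ x = -1) → (y = 1 ∨ y = -1) → x * y = -1 → y = -x := by
        rintro x y (rfl | rfl) (rfl | rfl) <;> simp
      have ng : ∀ x : ℤ, (x = 1 ∨ x = -1) → (-x = 1 ∨ -x = -1) := by
        intro x hx; omega
      by_cases e1 : k = i
      · subst e1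
        by_cases e2 : l = j
        · subst e2
          exfalso
          simp only [hij, hij.symm, if_true, if_false, add_zero, zero_add, mul_zero, mul_one] at h12
          rcases ha with rfl | rfl <;> rcases hb with rfl | rfl <;> rcases hc with rfl | rfl <;>
            rcases hd with rfl | rfl <;> omega
        · have e3 : a * c = -1 := by
            simpa [hij, hkl.symm, hkl, hij.symm, e2, mul_comm, Ne.symm e2] using h12
          have := opp a c ha hc e3
          subst this
          refine ⟨j, k, l, b, -a, -d, hij.symm, hkl, Ne.symm e2, hb, ng _ ha, ng _ hd, ?_, ?_⟩
          · rw [h1, Pi.single_neg]; abel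
          · rw [h2, Pi.single_neg, Pi.single_neg]; abel
      · by_cases e2 : k = j
        · subst e2
          by_cases e3 : l = i
          · subst e3
            exfalso
            simp only [hij, hij.symm, if_true, if_false, add_zero, zero_add, mul_zero, mul_one] at h12
            rcases ha with rfl | rfl <;> rcases hb with rfl | rfl <;>
              rcases hc with rfl | rfl <;> rcases hd with rfl | rfl <;> omega
          · have e4 : b * c = -1 := by
              simpa [hij, hkl.symm, hkl, hij.symm, e3, mul_comm, Ne.symm e3] using h12
            have := opp b c hb hc e4
            subst this
            refine ⟨i, k, l, a, -b, -d, hij, hkl, Ne.symm e3, ha, ng _ hb, ng _ hd, ?_, ?_⟩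
            · rw [h1, Pi.single_neg]; abel
            · rw [h2, Pi.single_neg, Pi.single_neg]; abel
        · by_cases e3 : l = i
          · subst e3
            have e4 : a * d = -1 := by
              simpa [hij, hij.symm, e1, e2, Ne.symm e1, Ne.symm e2, mul_comm] using h12
            have := opp a d ha hd e4
            subst this
            refine ⟨j, l, k, b, -a, -c, hij.symm, Ne.symm e1, Ne.symm e2, hb, ng _ ha,
              ng _ hc, ?_, ?_⟩
            · rw [h1, Pi.single_neg]; abel
            · rw [h2, Pi.single_neg, Pi.single_neg]; abel
          · by_cases e4 : l = j
            · subst e4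
              have e5 : b * d = -1 := by
                simpa [hij, hij.symm, e1, e2, Ne.symm e1, Ne.symm e2, mul_comm] using h12
              have := opp b d hb hd e5
              subst this
              refine ⟨i, l, k, a, -b, -c, hij, Ne.symm e2, Ne.symm e1, ha, ng _ hb,
                ng _ hc, ?_, ?_⟩
              · rw [h1, Pi.single_neg]; abel
              · rw [h2, Pi.single_neg, Pi.single_neg]; abel
            · exfalso
              simp [e1, e2, e3, e4, Ne.symm e1, Ne.symm e2, Ne.symm e3, Ne.symm e4] at h12
    obtain ⟨i, j, l, a, b, c, hij, hjl, hil, ha, hb, hc, h1, h2⟩ := main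
    refine ⟨fun k => if k = 0 then i else if k = 1 then j else l,
      fun k => if k = 0 then a else if k = 1 then b else c, ?_, ?_, ?_⟩
    · intro k; dsimp only; split_ifs <;> assumption
    · intro k m hk hm h
      interval_cases k <;> interval_cases m <;> simp_all
    · intro k hk
      interval_cases k <;> simp [h1, h2]
  | succ L hL ih =>
    intro hn
    obtain ⟨F, t, ht, hF, hv⟩ := ih (by omega)
    have pair : ∀ (w : I → ℤ) k, k < L → v (k + 1) ⬝ᵥ w =
        t k * w (F k) - t (k + 1) * w (F (k + 1)) := by
      intro w k hk
      rw [hv k hk]; simp [sub_dotProduct]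
    set u := v (L + 1) with hu
    have hun : u ⬝ᵥ u = 2 := hnorm _ (by omega) hn
    have hc : ∀ k, k ≤ L - 1 → t k * u (F k) = t 0 * u (F 0) := by
      apply qm_const (fun k => t k * u (F k))
      intro k hk
      have e := pair u k (by omega)
      rw [horth (k + 1) (L + 1) (by omega) hn] at e
      linarith
    have hcL : t L * u (F L) = t 0 * u (F 0) + 1 := by
      have e := pair u (L - 1) (by omega)
      rw [show L - 1 + 1 = L by omega, hc (L - 1) le_rfl, hadj L hn] at e
      linarith
    have hb := qm_bound u F t ht (L + 1) hF
    rw [Finset.sum_range_succ, hcL, hun,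
      Finset.sum_congr rfl (g := fun _ => (t 0 * u (F 0)) ^ 2)
        (fun k hk => by rw [hc k (by have := Finset.mem_range.1 hk; omega)])] at hb
    simp only [Finset.sum_const, Finset.card_range, nsmul_eq_mul] at hb
    have hL' : (2 : ℤ) ≤ L := by exact_mod_cast hL
    generalize hx : t 0 * u (F 0) = x at *
    have hx2 : 2 * x ^ 2 + (x + 1) ^ 2 ≤ 2 := by nlinarith [sq_nonneg x]
    have hx3 : x = 0 ∨ x = -1 := by
      have : x < 1 := by nlinarith
      have : -2 < x := by nlinarith
      omega
    obtain ⟨i, j, a, b, hij, ha, hb', hu2⟩ := qm_norm_two u hun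
    have uz : ∀ r, u r ≠ 0 → r = i ∨ r = j := by
      intro r hr
      by_contra! hh
      apply hr
      rw [hu2]; simp [hh.1, hh.2]
    have ui : u i = a := by rw [hu2]; simp [hij]
    have uj : u j = b := by rw [hu2]; simp [hij.symm]
    rcases hx3 with rfl | rfl
    · have main : ∃ (j : I) (b : ℤ), (b = 1 ∨ b = -1) ∧ F L ≠ j ∧ u j ≠ 0 ∧
          u = Pi.single (F L) (t L) - Pi.single j b := by
        have ne : u (F L) ≠ 0 := by intro h; simp [h] at hcL
        have opp : ∀ x y : ℤ, (x = 1 ∨ x = -1) → (y = 1 ∨ y = -1) → x * y = 0 + 1 → y = x := by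
          rintro x y (rfl | rfl) (rfl | rfl) <;> simp
        rcases uz _ ne with h | h
        · rw [h, ui] at hcL
          have := opp _ _ (ht L) ha hcL
          refine ⟨j, -b, by omega, by rwa [h], by rw [uj]; omega, ?_⟩
          rw [h, ← this, Pi.single_neg, hu2]; abel
        · rw [h, uj] at hcL
          have := opp _ _ (ht L) hb' hcL
          refine ⟨i, -a, by omega, by rw [h]; exact hij.symm, by rw [ui]; omega, ?_⟩
          rw [h, ← this, Pi.single_neg, hu2]; abel
      obtain ⟨j, b, hb, hj, huj, hu3⟩ := main
      have fresh : ∀ k, k < L + 1 → F k ≠ j := by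
        intro k hk h
        by_cases e : k = L
        · subst e; exact hj h
        · have := hc k (by omega)
          rw [h] at this
          rcases ht k with h | h <;> rw [h] at this <;> simp at this <;> exact huj this
      refine ⟨fun k => if k = L + 1 then j else F k, fun k => if k = L + 1 then b else t k,
        ?_, ?_, ?_⟩
      · intro k; dsimp only; split_ifs
        · exact hb
        · exact ht k
      · intro k l hk hl h
        dsimp only at h
        split_ifs at h with h1 h2 h2
        · omega
        · exact absurd h.symm (fresh l (by omega))
        · exact absurd h (fresh k (by omega))
        · exact hF k l (by omega) (by omega) h
      · intro k hk
        by_cases e : k = L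
        · subst e
          simpa using hu3
        · have e1 : k ≠ L + 1 := by omega
          simp only [e, e1, if_false, Nat.add_right_cancel_iff]
          exact hv k (by omega)
    · exfalso
      have h0 : v 0 ⬝ᵥ u = 0 := horth 0 (L + 1) (by omega) hn
      have h1 : v 1 ⬝ᵥ v 0 = -1 := by rw [dotProduct_comm]; exact hadj 0 (by omega)
      rw [pair (v 0) 0 (by omega)] at h1
      rw [hu2] at h0
      simp at h0
      have hc1 := hc 1 (by omega)
      have n0 : u (F 0) ≠ 0 := by intro h; simp [h] at hx
      have n1 : u (F 1) ≠ 0 := by intro h; simp [h] at hc1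
      have n01 : F 0 ≠ F 1 := fun h => by
        have := hF 0 1 (by omega) (by omega) h
        omega
      have par : v 0 (F 0) + v 0 (F 1) = v 0 i + v 0 j := by
        rcases uz _ n0 with e | e <;> rcases uz _ n1 with e' | e'
        · exact absurd (e.trans e'.symm) n01
        · rw [e, e']
        · rw [e, e', add_comm]
        · exact absurd (e.trans e'.symm) n01
      simp only [Nat.zero_add] at h1
      rcases ht 0 with q | q <;> rcases ht 1 with q' | q' <;> rw [q, q'] at h1 <;>
        rcases ha with rfl | rfl <;> rcases hb' with rfl | rfl <;> omega

lemma qm_gram {I C : Type*} [Fintype I] [DecidableEq I] [Fintype C] [DecidableEq C]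
    (n : ℕ) (hn3 : 3 ≤ n) (hcard : Fintype.card I = Fintype.card C * n)
    (v : C → ℕ → I → ℤ)
    (hnorm : ∀ c k, 1 ≤ k → k < n → v c k ⬝ᵥ v c k = 2)
    (hadj : ∀ c k, k + 1 < n → v c k ⬝ᵥ v c (k + 1) = -1)
    (horth : ∀ c k l, k + 2 ≤ l → l < n → v c k ⬝ᵥ v c l = 0)
    (hdisj : ∀ c d k l, c ≠ d → k < n → l < n → 1 ≤ l → v c k ⬝ᵥ v d l = 0) :
    ∃ B : C → C → ℤ, ∀ c d, v c 0 ⬝ᵥ v d 0 =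
      n * ∑ e, B c e * B d e - B c d - B d c + if c = d then 1 else 0 := by
  have ex := fun c => qm_chain n (v c) (hnorm c) (hadj c) (horth c) (n - 1) (by omega) (by omega)
  choose F t ht hF hv using ex
  have pair : ∀ (w : I → ℤ) c k, k + 1 < n → w ⬝ᵥ v c (k + 1) =
      t c k * w (F c k) - t c (k + 1) * w (F c (k + 1)) := by
    intro w c k hk
    rw [hv c k (by omega)]; simp [dotProduct_sub, mul_comm]
  have hF' : ∀ c k l, k < n → l < n → F c k = F c l → k = l := by
    intro c k l hk hl; exact hF c k l (by omega) (by omega)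
  -- vectors of other chains vanish on the support
  have vanish : ∀ c d l, c ≠ d → 1 ≤ l → l < n → ∀ k, k < n → v d l (F c k) = 0 := by
    intro c d l hcd hl hln
    have hc : ∀ k, k ≤ n - 1 → t c k * v d l (F c k) = t c 0 * v d l (F c 0) := by
      apply qm_const (fun k => t c k * v d l (F c k))
      intro k hk
      have e := pair (v d l) c k (by omega)
      rw [hdisj d c l (k + 1) (Ne.symm hcd) hln (by omega) (by omega)] at e
      linarith
    have hb := qm_bound (v d l) (F c) (t c) (ht c) n (hF' c)
    rw [hnorm d l hl hln, Finset.sum_congr rfl (g := fun _ => (t c 0 * v d l (F c 0)) ^ 2)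
        (fun k hk => by rw [hc k (by have := Finset.mem_range.1 hk; omega)])] at hb
    simp only [Finset.sum_const, Finset.card_range, nsmul_eq_mul] at hb
    have hn' : (3 : ℤ) ≤ n := by exact_mod_cast hn3
    have hz : t c 0 * v d l (F c 0) = 0 := by
      by_contra hne
      have : 0 < (t c 0 * v d l (F c 0)) ^ 2 := by positivity
      nlinarith
    intro k hk
    have := hc k (by omega)
    rw [hz] at this
    rcases ht c k with h | h <;> rw [h] at this <;> simpa using this
  have inj : Function.Injective (fun x : C × Fin n => F x.1 x.2) := by
    rintro ⟨c, k⟩ ⟨d, l⟩ h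
    dsimp only at h
    by_cases hcd : c = d
    · subst hcd
      have := hF' c k l k.2 l.2 h
      rw [Fin.ext this]
    · exfalso
      have supp : ∃ l', 1 ≤ l' ∧ l' < n ∧ v d l' (F d l) ≠ 0 := by
        by_cases h0 : (l : ℕ) + 1 < n
        · refine ⟨l + 1, by omega, h0, ?_⟩
          rw [hv d l (by omega)]
          have : F d l ≠ F d (l + 1) := fun h => by
            have := hF' d _ _ l.2 h0 h
            omega
          simp [this]
          rcases ht d l with h | h <;> omega
        · refine ⟨l, by omega, l.2, ?_⟩
          obtain ⟨m, hm⟩ : ∃ m, (l : ℕ) = m + 1 := ⟨l - 1, by omega⟩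
          have hl2 := l.2
          rw [hm] at hl2 ⊢
          rw [hv d m (by omega)]
          have : F d (m + 1) ≠ F d m := fun h => by
            have := hF' d _ _ hl2 (by omega) h
            omega
          simp [this]
          rcases ht d (m + 1) with h | h <;> omega
      obtain ⟨l', h1, h2, h3⟩ := supp
      rw [← h] at h3
      exact h3 (vanish c d l' hcd h1 h2 k k.2)
  have bij : Function.Bijective (fun x : C × Fin n => F x.1 x.2) := by
    rw [Fintype.bijective_iff_injective_and_card]
    refine ⟨inj, ?_⟩
    rw [hcard, Fintype.card_prod, Fintype.card_fin]
  refine ⟨fun c e => t e 1 * v c 0 (F e 1), ?_⟩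
  have b0 : ∀ c e, t e 0 * v c 0 (F e 0) =
      t e 1 * v c 0 (F e 1) - if c = e then 1 else 0 := by
    intro c e
    have h := pair (v c 0) e 0 (by omega)
    split_ifs with hce
    · subst hce
      rw [hadj c 0 (by omega)] at h
      simp only [Nat.zero_add] at h; linarith
    · rw [hdisj c e 0 (0 + 1) hce (by omega) (by omega) (by omega)] at h
      simp only [Nat.zero_add] at h; linarith
  have bk : ∀ c e k, k ≤ n - 2 → t e (k + 1) * v c 0 (F e (k + 1)) = t e 1 * v c 0 (F e 1) := by
    intro c e
    apply qm_const (fun k => t e (k + 1) * v c 0 (F e (k + 1)))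
    intro k hk
    have h := pair (v c 0) e (k + 1) (by omega)
    have : v c 0 ⬝ᵥ v e (k + 1 + 1) = 0 := by
      by_cases hce : c = e
      · subst hce; exact horth c 0 _ (by omega) (by omega)
      · exact hdisj c e 0 _ hce (by omega) (by omega) (by omega)
    rw [this] at h
    linarith
  intro c d
  have h1 : v c 0 ⬝ᵥ v d 0 = ∑ e, ∑ k ∈ Finset.range n,
      (t e k * v c 0 (F e k)) * (t e k * v d 0 (F e k)) := by
    rw [dotProduct, ← bij.sum_comp, Fintype.sum_prod_type]
    refine Finset.sum_congr rfl fun e _ => ?_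
    rw [Finset.sum_range]
    refine Finset.sum_congr rfl fun k _ => ?_
    rcases ht e k with h | h <;> rw [h] <;> ring
  rw [h1]
  obtain ⟨n', rfl⟩ : ∃ n', n = n' + 1 := ⟨n - 1, by omega⟩
  have h2 : ∀ e, ∑ k ∈ Finset.range (n' + 1),
      (t e k * v c 0 (F e k)) * (t e k * v d 0 (F e k)) =
      ((n' + 1 : ℕ) : ℤ) * ((t e 1 * v c 0 (F e 1)) * (t e 1 * v d 0 (F e 1)))
       - (if d = e then t e 1 * v c 0 (F e 1) else 0)
       - (if c = e then t e 1 * v d 0 (F e 1) else 0)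
       + (if c = e then if d = e then 1 else 0 else 0) := by
    intro e
    rw [Finset.sum_range_succ', b0, b0, Finset.sum_congr rfl
      (g := fun _ => (t e 1 * v c 0 (F e 1)) * (t e 1 * v d 0 (F e 1)))
      (fun k hk => by
        have := Finset.mem_range.1 hk
        rw [bk c e k (by omega), bk d e k (by omega)])]
    simp only [Finset.sum_const, Finset.card_range, nsmul_eq_mul]
    push_cast
    split_ifs <;> ring
  simp only [h2, Finset.sum_add_distrib, Finset.sum_sub_distrib, ← Finset.mul_sum]
  simp [eq_comm]

lemma qm_arith {C : Type*} [Fintype C] [DecidableEq C] (n : ℕ) (M : ℤ) (hM : 0 < M)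
    (hn : M + 2 ≤ n) (B : C → C → ℤ) (c d e : C) (hcd : c ≠ d) (hce : c ≠ e) (hde : d ≠ e)
    (hself : ∀ c, n * ∑ e, B c e * B c e = 2 * M + 2 * B c c)
    (hd : n * ∑ x, B c x * B d x = -M + B c d + B d c)
    (he : n * ∑ x, B c x * B e x = -M + B c e + B e c) : False := by
  have le1 : ∀ c x, B c x * B c x ≤ ∑ e, B c e * B c e := fun c x =>
    Finset.single_le_sum (f := fun x => B c x * B c x)
      (fun i _ => mul_self_nonneg (B c i)) (Finset.mem_univ x)
  have le2 : ∀ c x y, x ≠ y → B c x * B c x + B c y * B c y ≤ ∑ e, B c e * B c e := by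
    intro c x y hxy
    rw [← Finset.sum_pair (f := fun x => B c x * B c x) hxy]
    exact Finset.sum_le_sum_of_subset_of_nonneg (Finset.subset_univ _)
      fun i _ _ => mul_self_nonneg _
  have S1 : ∀ c, ∑ e, B c e * B c e = 1 := by
    intro c
    have h1 := hself c
    have h2 := le1 c c
    generalize ∑ e, B c e * B c e = S at *
    generalize B c c = x at *
    have x1 : x ≤ 1 := by
      by_contra! h
      have : (n : ℤ) * (x * x) ≤ n * S := by gcongr
      have h4 : 2 ≤ x * x - 2 := by nlinarith
      have : 3 * (x * x - 2) ≤ (n : ℤ) * (x * x - 2) := by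
        apply mul_le_mul_of_nonneg_right <;> omega
      nlinarith
    have x2 : -1 ≤ x := by
      by_contra! h
      have : (n : ℤ) * (x * x) ≤ n * S := by gcongr
      have h4 : 2 ≤ x * x - 2 := by nlinarith
      have : 3 * (x * x - 2) ≤ (n : ℤ) * (x * x - 2) := by
        apply mul_le_mul_of_nonneg_right <;> omega
      nlinarith
    have : S < 2 := by nlinarith
    have : 0 ≤ S := by nlinarith
    have : S ≠ 0 := by
      rintro rfl
      have : x = 0 := by nlinarith
      subst this
      omega
    omega
  have sm : ∀ c x, -1 ≤ B c x ∧ B c x ≤ 1 := by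
    intro c x
    have := le1 c x
    rw [S1] at this
    constructor <;> nlinarith
  have hx : ∀ c, (n : ℤ) = 2 * M + 2 * B c c := by
    intro c
    have := hself c
    rw [S1] at this; linarith
  have hh : ∀ d, c ≠ d → n * ∑ x, B c x * B d x = -M + B c d + B d c →
      B c c = 0 ∧ B c d * B c d = 1 := by
    intro d hcd hd
    have q1 := le2 c c d hcd
    have q2 := le2 d d c hcd.symm
    rw [S1] at q1 q2
    have r1 := hx c
    have r2 := hx d
    have r3 : B d d = B c c := by linarith
    rw [r3] at q2
    generalize ∑ x, B c x * B d x = S at hd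
    have a1 := sm c c
    have a2 := sm c d
    have a3 := sm d c
    generalize B c c = x at *
    generalize B c d = y at *
    generalize B d c = z at *
    by_cases h0 : x = 0
    · subst h0
      refine ⟨rfl, ?_⟩
      have hn2 : (n : ℤ) = 2 * M := by linarith
      rw [hn2] at hd
      have e1 : y + z = M * (2 * S + 1) := by linarith
      have M2 : 2 ≤ M := by omega
      have : y ≠ 0 := by
        rintro rfl
        rcases le_or_gt 0 S with h | h <;> nlinarith
      have : y = 1 ∨ y = -1 := by omega
      rcases this with rfl | rfl <;> rfl
    · exfalso
      have : x * x = 1 := by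
        have : x = 1 ∨ x = -1 := by omega
        rcases this with rfl | rfl <;> rfl
      have hy : y = 0 := by nlinarith
      have hz : z = 0 := by nlinarith
      subst hy hz
      have : S < 0 := by nlinarith
      nlinarith
  have f1 := hh d hcd hd
  have f2 := hh e hce he
  have := le2 c d e hde
  rw [S1] at this
  omega

theorem QmatSum_not_embed_neg_diagonal (p n N : ℕ) (m : ℤ)
    (hp : 2 < p) (hm : m < 0) (hn : (n : ℤ) ≥ -m + 2) (hN : 1 ≤ N) :
    ¬ ∃ A : Matrix (Fin N × Fin n × Fin p) (Fin N × Fin n × Fin p) ℤ,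
      QmatSum N p n m = -(Aᵀ * A) := by
  rintro ⟨A, hA⟩
  let v : (Fin N × Fin p) → ℕ → (Fin N × Fin n × Fin p) → ℤ := fun c k r =>
    if h : k < n then A r (c.1, ⟨k, h⟩, c.2) else 0
  have hv : ∀ c d k l (hk : k < n) (hl : l < n), v c k ⬝ᵥ v d l =
      -QmatSum N p n m (c.1, ⟨k, hk⟩, c.2) (d.1, ⟨l, hl⟩, d.2) := by
    intro c d k l hk hl
    rw [hA]
    simp [v, hk, hl, Matrix.mul_apply, dotProduct]
  obtain ⟨B, hB⟩ := qm_gram (C := Fin N × Fin p) n (by omega)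
    (by simp only [Fintype.card_prod, Fintype.card_fin]; ring) v
    (by
      intro c k h1 hk
      rw [hv c c k k hk hk]
      simp [QmatSum, Qmat]; omega)
    (by
      intro c k hk
      rw [hv c c k (k + 1) (by omega) hk]
      simp [QmatSum, Qmat])
    (by
      intro c k l hkl hl
      rw [hv c c k l (by omega) hl]
      simp [QmatSum, Qmat]
      have : k ≠ l := by omega
      simp [this]; omega)
    (by
      intro c d k l hcd hk hl h1
      rw [hv c d k l hk hl]
      by_cases e1 : c.1 = d.1
      · have e2 : c.2 ≠ d.2 := fun h => hcd (Prod.ext e1 h)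
        simp [QmatSum, Qmat, e1, e2]
        omega
      · simp [QmatSum, e1])
  have hn0 : 0 < n := by omega
  have hself : ∀ c, n * ∑ e, B c e * B c e = 2 * (-m) + 2 * B c c := by
    intro c
    have h := hB c c
    rw [hv c c 0 0 hn0 hn0] at h
    simp [QmatSum, Qmat] at h
    linarith
  let s : Fin N := ⟨0, hN⟩
  have hadj : ∀ i j : Fin p, i ≠ j →
      (((i : ℕ) + 1) % p = (j : ℕ) ∨ ((j : ℕ) + 1) % p = (i : ℕ)) →
      n * ∑ x, B (s, i) x * B (s, j) x = -(-m) + B (s, i) (s, j) + B (s, j) (s, i) := by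
    intro i j hij h'
    have h := hB (s, i) (s, j)
    rw [hv _ _ 0 0 hn0 hn0] at h
    simp [QmatSum, Qmat, hij, h'] at h
    linarith
  have i1 : (⟨1, by omega⟩ : Fin p) ≠ ⟨0, by omega⟩ := by simp
  have i2 : (⟨1, by omega⟩ : Fin p) ≠ ⟨2, by omega⟩ := by simp
  have i3 : (⟨0, by omega⟩ : Fin p) ≠ ⟨2, by omega⟩ := by simp
  refine qm_arith n (-m) (by omega) hn B (s, ⟨1, by omega⟩) (s, ⟨0, by omega⟩) (s, ⟨2, by omega⟩)
    (by simp) (by simp) (by simp) hself (hadj _ _ i1 (Or.inr ?_)) (hadj _ _ i2 (Or.inl ?_))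
  · exact Nat.mod_eq_of_lt (show 0 + 1 < p by omega)
  · exact Nat.mod_eq_of_lt (show 1 + 1 < p by omega)
end

section
/- Let p > 2 and m < 0 be integers, and set n = -m + 1. Then Q_p(m,n) embeds in ⟨-1⟩^{np}; that is, there exists an np × np integer matrix A with Q_p(m,n) = -Aᵀ·A. -/
open Matrix

/-- cyclic successor -/
def cycS (p : ℕ) (i : Fin p) : Fin p := ⟨((i : ℕ) + 1) % p, Nat.mod_lt _ (by have := i.2; omega)⟩

lemma cycS_val (p : ℕ) (i : Fin p) :
    ((cycS p i : Fin p) : ℕ) = if (i : ℕ) + 1 = p then 0 else (i : ℕ) + 1 := by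
  unfold cycS
  have := i.2
  split_ifs with h
  · simp [h]
  · exact Nat.mod_eq_of_lt (by omega)

lemma cycS_inj (p : ℕ) (i j : Fin p) : cycS p i = cycS p j ↔ i = j := by
  rw [Fin.ext_iff, Fin.ext_iff, cycS_val, cycS_val]
  have := i.2
  have := j.2
  grind

lemma cycS_ne (p : ℕ) (hp : 2 < p) (i : Fin p) : cycS p i ≠ i := by
  rw [Ne, Fin.ext_iff, cycS_val]
  grind

lemma cycS_cycS_ne (p : ℕ) (hp : 2 < p) (i : Fin p) : cycS p (cycS p i) ≠ i := by
  rw [Ne, Fin.ext_iff, cycS_val, cycS_val]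
  grind

/-- delta -/
def dl {α : Type} [DecidableEq α] (a b : α) : ℤ := if a = b then 1 else 0

lemma sum_dl {α : Type} [DecidableEq α] [Fintype α] (a : α) (f : α → ℤ) :
    ∑ b, dl b a * f b = f a := by
  simp [dl]

/-- coefficients -/
def cc (p : ℕ) (i j : Fin p) : ℤ := dl j i - dl j (cycS p i)

lemma sum_cc (p : ℕ) (i : Fin p) (f : Fin p → ℤ) :
    ∑ j, cc p i j * f j = f i - f (cycS p i) := by
  simp only [cc, sub_mul, Finset.sum_sub_distrib, sum_dl]

/-- columns -/
def colv (p N : ℕ) (k : Fin (N+1)) (i : Fin p) (l : Fin (N+1)) (j : Fin p) : ℤ :=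
  Fin.cases (cc p i j - dl l 0 * dl j i)
    (fun k' => dl j i * (dl l k'.castSucc - dl l k'.succ)) k

lemma sum_zero (p N : ℕ) (i : Fin p) (f : Fin (N+1) → Fin p → ℤ) :
    ∑ l, ∑ j, colv p N 0 i l j * f l j
      = (∑ l, (f l i - f l (cycS p i))) - f 0 i := by
  simp only [colv, Fin.cases_zero, sub_mul, Finset.sum_sub_distrib, sum_cc, mul_assoc,
    ← Finset.mul_sum, sum_dl]

lemma sum_succ (p N : ℕ) (k : Fin N) (i : Fin p) (f : Fin (N+1) → Fin p → ℤ) :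
    ∑ l, ∑ j, colv p N k.succ i l j * f l j = f k.castSucc i - f k.succ i := by
  simp only [colv, Fin.cases_succ, mul_assoc, sum_dl, sub_mul, Finset.sum_sub_distrib]

lemma sum_dl' {α : Type} [DecidableEq α] [Fintype α] (a : α) :
    ∑ b, dl b a = 1 := by
  simp [dl]

/-- Example 3.2, first part: for `p > 2`, `m < 0` and `n = -m + 1`, the form
`Q_p(m,n)` embeds in `⟨-1⟩^{np}`: there is an integer matrix `A` of the same
size with `Q_p(m,n) = -Aᵀ·A`. -/
theorem Qmat_embed_of_eq_neg_add_one (p n : ℕ) (m : ℤ)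
    (hp : 2 < p) (hm : m < 0) (hn : (n : ℤ) = -m + 1) :
    ∃ A : Matrix (Fin n × Fin p) (Fin n × Fin p) ℤ, Qmat p n m = -(Aᵀ * A) := by
  obtain ⟨N, rfl⟩ : ∃ N, n = N + 1 := ⟨n - 1, by omega⟩
  have hmN : m = -(N : ℤ) := by push_cast at hn; omega
  subst hmN
  refine ⟨Matrix.of fun x y => colv p N y.1 y.2 x.1 x.2, ?_⟩
  ext ⟨k, i⟩ ⟨k', i'⟩
  simp only [Matrix.neg_apply, Matrix.mul_apply, Matrix.transpose_apply, Matrix.of_apply,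
    Fintype.sum_prod_type]
  have h1 : ∀ a b : Fin p, ((a : ℕ) + 1) % p = (b : ℕ) ↔ cycS p a = b := by
    intro a b; rw [Fin.ext_iff]; rfl
  simp only [Qmat, Matrix.of_apply, h1]
  have e1 := cycS_ne p hp
  have e2 := cycS_cycS_ne p hp
  have e3 := cycS_inj p
  induction k using Fin.cases with
  | zero =>
    rw [sum_zero]
    induction k' using Fin.cases with
    | zero =>
      simp only [colv, Fin.cases_zero, Finset.sum_sub_distrib, ← Finset.sum_mul, sum_dl',
        Finset.sum_const, Finset.card_univ, Fintype.card_fin, nsmul_eq_mul]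
      simp only [cc, dl, e3]
      have := e1 i
      have := e1 i'
      have := e2 i
      have := e2 i'
      push_cast
      by_cases a : i = i'
      · subst a
        simp [e1, (e1 _).symm]
        ring
      · by_cases b : cycS p i = i'
        · subst b
          simp [e1, (e1 _).symm, e2, (e2 _).symm, a]
        · by_cases c : cycS p i' = i
          · subst c
            simp [e1, (e1 _).symm, e2, (e2 _).symm, a]
          · simp [a, b, c, Ne.symm a, Ne.symm b, Ne.symm c]
    | succ k' =>
      simp only [colv, Fin.cases_succ, Finset.sum_sub_distrib, ← Finset.mul_sum, sum_dl']
      simp only [dl, Fin.ext_iff, Fin.val_succ, Fin.val_castSucc, Fin.val_zero]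
      grind
  | succ k =>
    rw [sum_succ]
    induction k' using Fin.cases with
    | zero =>
      simp only [colv, Fin.cases_zero]
      simp only [dl, Fin.ext_iff, Fin.val_succ, Fin.val_castSucc, Fin.val_zero]
      grind
    | succ k' =>
      simp only [colv, Fin.cases_succ]
      simp only [dl, Fin.ext_iff, Fin.val_succ, Fin.val_castSucc, Fin.val_zero]
      grind
end

section
/- Let p > 2 be an odd integer and let m < 0 be an integer, and set n = -m. Then Q_p(m,n) embeds in ⟨-1⟩^{np}; that is, there exists an np × np integer matrix A with Q_p(m,n) = -Aᵀ·A. -/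
open Matrix

def fE {G : Type} [DecidableEq G] (i j : G) : ℤ := if j = i then 1 else 0

lemma fE_sum {G : Type} [DecidableEq G] [Fintype G] (i : G) (g : G → ℤ) :
    ∑ j, fE i j * g j = g i := by
  simp [fE]

lemma fE_comm {G : Type} [DecidableEq G] (i j : G) : fE i j = fE j i := by
  simp [fE, eq_comm]

def fD {G : Type} [DecidableEq G] [AddCommGroup G] (a i j : G) : ℤ :=
  fE (i + a) j - fE (i - a) j

lemma fD_anti {G : Type} [DecidableEq G] [AddCommGroup G] (a i j : G) :
    fD a i j = - fD a j i := by
  have h1 : (j = i + a) ↔ (i = j - a) := by rw [eq_sub_iff_add_eq, eq_comm]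
  have h2 : (j = i - a) ↔ (i = j + a) := by rw [eq_sub_iff_add_eq, eq_comm]
  simp only [fD, fE, h1, h2]; ring

lemma fD_sum {G : Type} [DecidableEq G] [AddCommGroup G] [Fintype G] (a i : G) (g : G → ℤ) :
    ∑ j, fD a i j * g j = g (i + a) - g (i - a) := by
  simp only [fD, sub_mul, Finset.sum_sub_distrib, fE_sum]

lemma fD_fD {G : Type} [DecidableEq G] [AddCommGroup G] [Fintype G] (a i i' : G) :
    ∑ j, fD a i j * fD a i' j = 2 * fE i i' - fE (i + (a + a)) i' - fE (i' + (a + a)) i := by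
  rw [fD_sum]
  have h1 : (i + a = i' - a) ↔ (i' = i + (a + a)) := by
    rw [eq_sub_iff_add_eq, eq_comm, add_assoc]
  have h2 : (i - a = i' + a) ↔ (i = i' + (a + a)) := by
    rw [sub_eq_iff_eq_add, add_assoc]
  simp only [fD, fE, h1, h2, add_left_inj, sub_left_inj, eq_comm (a := i) (b := i')]
  ring

def fV {G : Type} [DecidableEq G] [AddCommGroup G] (N : ℕ) (a : G) (k : Fin (N + 1)) (i : G)
    (l : Fin (N + 1)) (j : G) : ℤ :=
  Fin.cases (motive := fun _ => ℤ) (fD a i j - fE 0 l * fE i j)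
    (fun k => (fE k.castSucc l - fE k.succ l) * fE i j) k

lemma fV_00 {G : Type} [DecidableEq G] [AddCommGroup G] [Fintype G] (N : ℕ) (a i i' : G) :
    ∑ l, ∑ j, fV N a 0 i l j * fV N a 0 i' l j =
      (N + 1) * (2 * fE i i' - fE (i + (a + a)) i' - fE (i' + (a + a)) i) + fE i i' := by
  have h : ∀ l : Fin (N + 1), ∑ j, fV N a 0 i l j * fV N a 0 i' l j =
      (2 * fE i i' - fE (i + (a + a)) i' - fE (i' + (a + a)) i)
       + fE 0 l * (fE 0 l * fE i i') := by
    intro l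
    rw [← fD_fD]
    have : ∀ j, fV N a 0 i l j * fV N a 0 i' l j = fD a i j * fD a i' j
       - fE 0 l * (fE i' j * fD a i j) - fE 0 l * (fE i j * fD a i' j)
       + fE 0 l * fE 0 l * (fE i j * fE i' j) := by
      intro j; simp only [fV, Fin.cases_zero]; ring
    simp only [this, Finset.sum_add_distrib, Finset.sum_sub_distrib, ← Finset.mul_sum, fE_sum]
    rw [fD_anti a i i', fE_comm i' i]; ring
  simp only [h, Finset.sum_add_distrib, fE_sum, Finset.sum_const, Finset.card_univ, Fintype.card_fin]
  simp only [nsmul_eq_mul, Nat.cast_add, Nat.cast_one]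
  simp only [show fE (0 : Fin (N + 1)) 0 = 1 by simp [fE], one_mul]

lemma fV_0s {G : Type} [DecidableEq G] [AddCommGroup G] [Fintype G] (N : ℕ) (a i i' : G)
    (k : Fin N) :
    ∑ l, ∑ j, fV N a k.succ i l j * fV N a 0 i' l j = - (fE 0 k.castSucc * fE i i') := by
  have h : ∀ l j, fV N a k.succ i l j * fV N a 0 i' l j =
      fE i j * ((fE k.castSucc l - fE k.succ l) * (fD a i' j - fE 0 l * fE i' j)) := by
    intro l j; simp only [fV, Fin.cases_zero, Fin.cases_succ]; ring
  simp only [h, fE_sum, sub_mul, Finset.sum_sub_distrib]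
  rw [fE_comm i' i]
  simp [fE]

lemma fV_ss {G : Type} [DecidableEq G] [AddCommGroup G] [Fintype G] (N : ℕ) (a i i' : G)
    (k k' : Fin N) :
    ∑ l, ∑ j, fV N a k.succ i l j * fV N a k'.succ i' l j =
      (2 * fE k k' - fE k.castSucc k'.succ - fE k.succ k'.castSucc) * fE i i' := by
  have h : ∀ l j, fV N a k.succ i l j * fV N a k'.succ i' l j =
      fE i j * ((fE k.castSucc l - fE k.succ l) * ((fE k'.castSucc l - fE k'.succ l) * fE i' j)) := by
    intro l j; simp only [fV, Fin.cases_succ]; ring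
  simp only [h, fE_sum, sub_mul, Finset.sum_sub_distrib]
  rw [fE_comm i' i]
  simp only [fE, Fin.castSucc_inj, Fin.succ_inj, eq_comm (a := k) (b := k'),
    eq_comm (a := k.castSucc), eq_comm (a := k.succ)]
  ring

open Fin.CommRing in
theorem Qmat_embed_of_eq_neg (p n : ℕ) (m : ℤ)
    (hp : 2 < p) (hodd : Odd p) (hm : m < 0) (hn : (n : ℤ) = -m) :
    ∃ A : Matrix (Fin n × Fin p) (Fin n × Fin p) ℤ, Qmat p n m = -(Aᵀ * A) := by
  obtain ⟨N, rfl⟩ : ∃ N, n = N + 1 := ⟨n - 1, by omega⟩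
  haveI : NeZero p := ⟨by omega⟩
  obtain ⟨b, hb⟩ := hodd
  obtain ⟨a, ha⟩ : ∃ a : Fin p, ∀ x y : Fin p, y = x + (a + a) ↔ ((x : ℕ) + 1) % p = y := by
    refine ⟨⟨b + 1, by omega⟩, fun x y => ?_⟩
    have : (⟨b + 1, by omega⟩ + ⟨b + 1, by omega⟩ : Fin p) = ⟨1, by omega⟩ := by
      ext
      rw [Fin.val_add]
      simp only
      rw [show b + 1 + (b + 1) = 1 + p by omega, Nat.add_mod_right, Nat.mod_eq_of_lt (by omega)]
    rw [this, Fin.ext_iff, Fin.val_add, eq_comm]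
  obtain rfl : m = -((N : ℤ) + 1) := by push_cast at hn; omega
  refine ⟨Matrix.of fun x y => fV N a y.1 y.2 x.1 x.2, ?_⟩
  ext ⟨k, i⟩ ⟨k', i'⟩
  rw [Matrix.neg_apply, Matrix.mul_apply, Fintype.sum_prod_type]
  simp only [Matrix.transpose_apply, Matrix.of_apply, Qmat]
  have hne : ∀ x : Fin p, ¬ ((x : ℕ) + 1) % p = x := by
    intro x h
    have hx := x.2
    rcases Nat.lt_or_ge ((x : ℕ) + 1) p with h1 | h1
    · rw [Nat.mod_eq_of_lt h1] at h; omega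
    · rw [show (x : ℕ) + 1 = p by omega, Nat.mod_self] at h; omega
  have hne2 : ∀ x y : Fin p, ((x : ℕ) + 1) % p = y → ¬ ((y : ℕ) + 1) % p = x := by
    intro x y h h'
    have hx := x.2
    have hy := y.2
    rcases Nat.lt_or_ge ((x : ℕ) + 1) p with h1 | h1
    · rw [Nat.mod_eq_of_lt h1] at h
      rcases Nat.lt_or_ge ((y : ℕ) + 1) p with h2 | h2
      · rw [Nat.mod_eq_of_lt h2] at h'; omega
      · rw [show (y : ℕ) + 1 = p by omega, Nat.mod_self] at h'; omega
    · rw [show (x : ℕ) + 1 = p by omega, Nat.mod_self] at h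
      rw [Nat.mod_eq_of_lt (by omega)] at h'; omega
  induction k using Fin.cases with
  | zero =>
    induction k' using Fin.cases with
    | zero =>
      rw [fV_00]
      simp only [fE, ha]
      by_cases h : i = i'
      · subst h; simp [hne]; ring
      · have h' : ¬ i' = i := fun e => h e.symm
        by_cases h1 : ((i : ℕ) + 1) % p = i'
        · simp [h, h', h1, hne2 _ _ h1]
        · by_cases h2 : ((i' : ℕ) + 1) % p = i
          · simp [h, h', h1, h2]
          · simp [h, h', h1, h2]
    | succ k' =>
      simp only [mul_comm (fV N a 0 i _ _)]
      rw [fV_0s]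
      simp only [fE, Fin.ext_iff, Fin.val_zero, Fin.val_succ, Fin.val_castSucc]
      split_ifs <;> first | omega | simp_all
  | succ k =>
    induction k' using Fin.cases with
    | zero =>
      rw [fV_0s]
      simp only [fE, Fin.ext_iff, Fin.val_zero, Fin.val_succ, Fin.val_castSucc]
      split_ifs <;> first | omega | simp_all
    | succ k' =>
      rw [fV_ss]
      simp only [fE, Fin.ext_iff, Fin.val_zero, Fin.val_succ, Fin.val_castSucc]
      split_ifs <;> first | omega | simp_all
end

section
/- Let n be an integer, let c ≥ 1 be an integer, let f ∈ ℤ[X] be a polynomial of degree at most c, and let ε ∈ {1, −1}. If n·X^{2c} − (2n+1)·X^c + n = ε · f · reflect_c(f) holds in ℤ[X], then there exists an integer k such that n = k·(k−1) or n = k². -/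
open Polynomial

lemma tk_norm_coeff (c : ℕ) (a : ℂ) (P : ℂ[X]) (hP : P.Monic) (hd : P ∣ X ^ c - C a) :
    ‖P.coeff 0‖ ^ c = ‖a‖ ^ P.natDegree := by
  have hs : P.Splits := IsAlgClosed.splits P
  rw [hs.coeff_zero_eq_prod_roots_of_monic hP, hs.natDegree_eq_card_roots, norm_mul, norm_pow,
    norm_neg, norm_one, one_pow, one_mul]
  have hr : ∀ r ∈ P.roots, ‖r‖ ^ c = ‖a‖ := by
    intro r hr
    have h1 : (X ^ c - C a).eval r = 0 := eval_eq_zero_of_dvd_of_eval_eq_zero hd (isRoot_of_mem_roots hr)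
    have h2 : r ^ c = a := by simpa [sub_eq_zero] using h1
    rw [← norm_pow, h2]
  generalize P.roots = s at hr
  induction s using Multiset.induction_on with
  | empty => simp
  | cons b s ih =>
    simp only [Multiset.prod_cons, Multiset.card_cons, norm_mul, mul_pow, pow_succ]
    rw [ih (fun r h => hr r (Multiset.mem_cons_of_mem h)), hr b (Multiset.mem_cons_self b s), mul_comm]

open Classical in
lemma tk_sqrt {K : Type*} [Field K] (φ : K →+* ℝ) (σ : K →+* K) (a b : K) (hσ : σ a = b)
    (hab : a ≠ b) (ha : 0 < φ a) (c : ℕ) (hc : 1 ≤ c) (F : K[X]) (hF : F.map σ = F)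
    (hdeg : F.natDegree = c) (hdvd : F ∣ (X ^ c - C a) * (X ^ c - C b)) :
    ∃ d : K, d ^ 2 = a := by
  have hF0 : F ≠ 0 := by rintro rfl; simp at hdeg; omega
  set P := EuclideanDomain.gcd F (X ^ c - C a) with hPdef
  have hPσ : P.map σ = EuclideanDomain.gcd F (X ^ c - C b) := by
    rw [hPdef, ← gcd_map, hF]; simp [hσ]
  have hPF : P ∣ F := EuclideanDomain.gcd_dvd_left _ _
  have hPA : P ∣ X ^ c - C a := EuclideanDomain.gcd_dvd_right _ _
  have hQF : P.map σ ∣ F := by rw [hPσ]; exact EuclideanDomain.gcd_dvd_left _ _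
  have hQB : P.map σ ∣ X ^ c - C b := by rw [hPσ]; exact EuclideanDomain.gcd_dvd_right _ _
  have hP0 : P ≠ 0 := fun h => hF0 (by rw [h] at hPF; exact zero_dvd_iff.1 hPF)
  have hQ0 : P.map σ ≠ 0 := by rwa [Ne, Polynomial.map_eq_zero]
  have hcop : IsCoprime (X ^ c - C a : K[X]) (X ^ c - C b) := by
    have hne : b - a ≠ 0 := sub_ne_zero.2 hab.symm
    refine ⟨C (b - a)⁻¹, - C (b - a)⁻¹, ?_⟩
    have : C (b - a)⁻¹ * (C b - C a) = (1 : K[X]) := by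
      rw [← C_sub, ← C_mul, inv_mul_cancel₀ hne, C_1]
    linear_combination this
  have hcop' : IsCoprime P (P.map σ) :=
    (hcop.of_isCoprime_of_dvd_left hPA).of_isCoprime_of_dvd_right hQB
  have h1 : P * P.map σ ∣ F := hcop'.mul_dvd hPF hQF
  have h2 : F ∣ P * P.map σ := by
    rw [hPσ, hPdef]
    obtain ⟨x, y, hx⟩ : ∃ x y, EuclideanDomain.gcd F (X ^ c - C a) = F * x + (X ^ c - C a) * y :=
      ⟨_, _, EuclideanDomain.gcd_eq_gcd_ab _ _⟩
    obtain ⟨z, w, hz⟩ : ∃ x y, EuclideanDomain.gcd F (X ^ c - C b) = F * x + (X ^ c - C b) * y :=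
      ⟨_, _, EuclideanDomain.gcd_eq_gcd_ab _ _⟩
    rw [hx, hz]
    obtain ⟨q, hq⟩ := hdvd
    exact ⟨x * (F * z + (X ^ c - C b) * w) + (X ^ c - C a) * y * z + q * y * w, by
      linear_combination y * w * hq⟩
  have h3 : 2 * P.natDegree = c := by
    have e1 := natDegree_le_of_dvd h1 hF0
    have e2 := natDegree_le_of_dvd h2 (mul_ne_zero hP0 hQ0)
    rw [natDegree_mul hP0 hQ0, natDegree_map] at e1 e2
    omega
  have hl : P.leadingCoeff ≠ 0 := leadingCoeff_ne_zero.2 hP0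
  set M := P * C P.leadingCoeff⁻¹ with hM
  have hMm : M.Monic := monic_mul_leadingCoeff_inv hP0
  have hMd : M.natDegree = P.natDegree := natDegree_mul_leadingCoeff_inv P hP0
  have hMA : M ∣ X ^ c - C a := by
    obtain ⟨q, hq⟩ := hPA
    refine ⟨C P.leadingCoeff * q, ?_⟩
    have : C P.leadingCoeff⁻¹ * C P.leadingCoeff = (1 : K[X]) := by
      rw [← C_mul, inv_mul_cancel₀ hl, C_1]
    rw [hM]
    linear_combination hq - P * q * this
  let ψ : K →+* ℂ := Complex.ofRealHom.comp φ
  have h4 := tk_norm_coeff c (ψ a) (M.map ψ) (hMm.map ψ) (by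
    have := Polynomial.map_dvd ψ hMA
    simpa using this)
  rw [natDegree_map, hMd, coeff_map] at h4
  have h5 : ∀ x, ‖ψ x‖ = |φ x| := fun x => by simp [ψ]
  rw [h5, h5, abs_of_pos ha, ← h3, pow_mul, sq_abs] at h4
  have h6 := (pow_left_inj₀ (sq_nonneg _) ha.le (by omega)).1 h4
  exact ⟨M.coeff 0, φ.injective (by rw [map_pow, h6])⟩

lemma tk_int_sq (n : ℤ) (q : ℚ) (h : (n : ℚ) = q ^ 2) : ∃ k : ℤ, n = k ^ 2 := by
  have h1 : IsSquare (n : ℚ) := ⟨q, by rw [h, sq]⟩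
  rw [Rat.isSquare_intCast_iff] at h1
  obtain ⟨k, hk⟩ := h1
  exact ⟨k, by rw [hk, sq]⟩

abbrev TKK (n : ℤ) := QuadraticAlgebra ℚ (4 * n + 1 : ℚ) 0

open scoped QuadraticAlgebra in
lemma tk_main (n : ℤ) (hn : 0 < n) (hsq : ¬ ∃ k : ℤ, 4 * n + 1 = k ^ 2) (c : ℕ) (hc : 1 ≤ c)
    (f g : ℤ[X]) (hf : f.natDegree = c)
    (h : C n * X ^ (2 * c) - C (2 * n + 1) * X ^ c + C n = f * g) :
    ∃ k : ℤ, n = k ^ 2 := by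
  have hnQ : (0 : ℚ) < n := by exact_mod_cast hn
  have hnR : (0 : ℝ) < n := by exact_mod_cast hn
  have : Fact (∀ r : ℚ, r ^ 2 ≠ (4 * n + 1 : ℚ) + 0 * r) := ⟨fun r hr => hsq
    (tk_int_sq _ r (by push_cast; linear_combination -hr))⟩
  have hs : (0:ℝ) ≤ 4 * n + 1 := by positivity
  let φ : (TKK n) →ₐ[ℚ] ℝ := QuadraticAlgebra.lift ⟨√(4 * n + 1), by
    rw [Real.mul_self_sqrt hs, Algebra.smul_def]; simp⟩
  let σ : (TKK n) →+* (TKK n) := starRingEnd (TKK n)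
  let a : (TKK n) := ⟨(2 * n + 1) / (2 * n), 1 / (2 * n)⟩
  let b : (TKK n) := ⟨(2 * n + 1) / (2 * n), - (1 / (2 * n))⟩
  have hσ : σ a = b := by
    show star a = b
    ext <;> simp [a, b]
  have hab : a ≠ b := by
    intro hab
    have := congrArg QuadraticAlgebra.im hab
    have h2 : (0:ℚ) < 1 / (2 * n) := by positivity
    simp only [a, b] at this
    linarith
  have hφ : 0 < φ a := by
    have : φ a = (2 * n + 1) / (2 * n) + 1 / (2 * n) * √(4 * n + 1) := by
      have e : φ a = a.re • (1 : ℝ) + a.im • √(4 * n + 1) := rfl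
      rw [e, Algebra.smul_def, Algebra.smul_def]; simp [a]
    rw [this]; positivity
  have hinj : Function.Injective (Int.castRingHom (TKK n)) := Int.cast_injective
  have hfac : C (n : (TKK n)) * X ^ (2 * c) - C (2 * n + 1 : (TKK n)) * X ^ c + C (n : (TKK n))
      = C (n : (TKK n)) * ((X ^ c - C a) * (X ^ c - C b)) := by
    have e1 : (n : (TKK n)) * (a + b) = 2 * n + 1 := by
      ext <;> simp [a, b]
      field_simp; ring
    have e2 : a * b = 1 := by
      ext <;> simp [a, b]
      · field_simp; ring
      · ring
    have e1' : C (n : (TKK n)) * (C a + C b) = C (2 * n + 1 : (TKK n)) := by rw [← e1]; simp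
    have e2' : C a * C b = (1 : (TKK n)[X]) := by rw [← C_mul, e2, C_1]
    rw [← e1']
    linear_combination - C (n : (TKK n)) * e2'
  have hmap := congrArg (Polynomial.map (Int.castRingHom (TKK n))) h
  have hmap' : C (n : (TKK n)) * ((X ^ c - C a) * (X ^ c - C b))
      = f.map (Int.castRingHom (TKK n)) * g.map (Int.castRingHom (TKK n)) := by
    rw [← hfac, ← Polynomial.map_mul, ← hmap]; simp; left; rfl
  have hnK : (n : (TKK n)) ≠ 0 := by exact_mod_cast hn.ne'
  obtain ⟨d, hd⟩ := tk_sqrt φ.toRingHom σ a b hσ hab hφ c hc (f.map (Int.castRingHom (TKK n)))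
    (by rw [Polynomial.map_map]; congr 1; exact RingHom.ext_int _ _)
    (by rw [natDegree_map_eq_of_injective hinj, hf])
    (by
      have hu : IsUnit (C (n : (TKK n))) := isUnit_C.2 (isUnit_iff_ne_zero.2 hnK)
      rw [← hu.dvd_mul_left, hmap']
      exact dvd_mul_right _ _)
  obtain ⟨x, y⟩ := d
  have hre := congrArg QuadraticAlgebra.re hd
  have him := congrArg QuadraticAlgebra.im hd
  rw [sq] at hre him
  simp only [QuadraticAlgebra.re_mul, QuadraticAlgebra.im_mul, a] at hre him
  field_simp at hre him
  have hxy : 4 * n * (x * y) = 1 := by linear_combination him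
  have hre' : 2 * n * (x ^ 2 + (4 * n + 1) * y ^ 2) = 2 * n + 1 := by linear_combination hre
  have key : (4 * n * x ^ 2 - 1) * (4 * n * x ^ 2 - (4 * n + 1)) = 0 := by
    linear_combination 8 * n * x ^ 2 * hre' - (4 * n + 1) * (4 * n * (x * y) + 1) * hxy
  rcases mul_eq_zero.1 key with h0 | h0
  · have hx : x ≠ 0 := by rintro rfl; norm_num at h0
    refine tk_int_sq n (1 / (2 * x)) ?_
    field_simp; linear_combination h0
  · obtain ⟨k, hk⟩ := tk_int_sq (n * (4 * n + 1)) (2 * n * x) (by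
      push_cast; linear_combination -n * h0)
    obtain ⟨m, hm | hm⟩ := Int.sq_of_isCoprime (show IsCoprime n (4 * n + 1) from ⟨-4, 1, by ring⟩) hk
    · exact ⟨m, hm⟩
    · nlinarith [sq_nonneg m]

/-- The number-theoretic core of Theorem 4.8: if the Alexander polynomial of the
twist knot `K_n` evaluated at `t^c` admits a Fox–Milnor factorization
`n·X^{2c} - (2n+1)·X^c + n = ε · f(X) · X^c f(1/X)` with `ε = ±1` and
`deg f ≤ c`, then `n = k(k-1)` or `n = k²` for some integer `k`. -/
theorem twist_knot_fox_milnor (n : ℤ) (c : ℕ) (hc : 1 ≤ c)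
    (f : Polynomial ℤ) (hf : f.natDegree ≤ c) (ε : ℤ) (hε : ε = 1 ∨ ε = -1)
    (h : C n * X ^ (2 * c) - C (2 * n + 1) * X ^ c + C n = C ε * (f * f.reflect c)) :
    ∃ k : ℤ, n = k * (k - 1) ∨ n = k ^ 2 := by
  have hrc : ∀ i ≤ c, (f.reflect c).coeff i = f.coeff (c - i) := fun i hi => by
    rw [coeff_reflect, revAt_le hi]
  -- evaluation at one
  have hev : ε = -1 := by
    have h1 := congrArg (eval 1) h
    have h2 : (f.reflect c).eval 1 = f.eval 1 := by
      let : Invertible (1 : ℤ) := invertibleOne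
      have := eval₂_reflect_mul_pow (RingHom.id ℤ) 1 c f hf
      simpa [eval₂_id] using this
    simp only [eval_add, eval_sub, eval_mul, eval_C, eval_pow, eval_X, one_pow, h2] at h1
    rcases hε with rfl | rfl
    · nlinarith [mul_self_nonneg (f.eval 1)]
    · rfl
  subst hev
  have hn0 : 0 ≤ n := by
    have h1 := congrArg (fun p => coeff p c) h
    simp only [coeff_add, coeff_sub, coeff_C_mul, coeff_X_pow, coeff_C] at h1
    rw [if_neg (by omega), if_pos trivial, if_neg (by omega), coeff_mul] at h1
    have h2 : 0 ≤ ∑ x ∈ Finset.HasAntidiagonal.antidiagonal c, f.coeff x.1 * (f.reflect c).coeff x.2 := by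
      refine Finset.sum_nonneg fun x hx => ?_
      rw [Finset.HasAntidiagonal.mem_antidiagonal] at hx
      rw [hrc _ (by omega), show c - x.2 = x.1 by omega]
      exact mul_self_nonneg _
    linarith
  rcases hn0.eq_or_lt with h0 | hn
  · exact ⟨0, by left; simp [← h0]⟩
  have hdeg : f.natDegree = c := by
    have h1 := congrArg (fun p => coeff p 0) h
    simp only [coeff_add, coeff_sub, coeff_C_mul, coeff_X_pow, coeff_C_zero, mul_coeff_zero] at h1
    rw [hrc 0 (by omega), if_neg (by omega), if_neg (by omega)] at h1
    refine le_antisymm hf (le_natDegree_of_ne_zero ?_)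
    intro hz
    simp at h1
    rw [hz] at h1
    simp at h1
    omega
  by_cases hsq : ∃ k : ℤ, 4 * n + 1 = k ^ 2
  · obtain ⟨k, hk⟩ := hsq
    rcases Int.even_or_odd' k with ⟨m, rfl | rfl⟩
    · ring_nf at hk; omega
    · exact ⟨m + 1, Or.inl (by nlinarith)⟩
  · obtain ⟨k, hk⟩ := tk_main n hn hsq c hc f (C (-1) * f.reflect c) hdeg (by rw [h]; ring)
    exact ⟨k, Or.inr hk⟩
end

section
/- Let n be an integer, let c ≥ 1 be an integer, let f ∈ ℤ[X] be a polynomial of degree at most c with coefficients a_0, a_1, …, a_c (where a_i is the coefficient of X^i), and let ε ∈ {1, −1}. If n·X^{2c} − (2n+1)·X^c + n = ε · f · reflect_c(f) holds in ℤ[X], then ε = −1, n = −a_0·a_c, and (a_0 + a_c)² + Σ_{i=1}^{c−1} a_i² = 1. -/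
open Polynomial

/-- Key intermediate computation in Theorem 4.8: if
`n·X^{2c} - (2n+1)·X^c + n = ε · f · reflect_c(f)` with `ε = ±1`, `c ≥ 1` and
`deg f ≤ c`, then `ε = -1`, `n = -a₀·a_c`, and
`(a₀ + a_c)² + Σ_{i=1}^{c-1} a_i² = 1`, where `a_i` is the coefficient of `X^i`
in `f`. -/
theorem twist_knot_fox_milnor_coeffs (n : ℤ) (c : ℕ) (hc : 1 ≤ c)
    (f : Polynomial ℤ) (hf : f.natDegree ≤ c) (ε : ℤ) (hε : ε = 1 ∨ ε = -1)
    (h : C n * X ^ (2 * c) - C (2 * n + 1) * X ^ c + C n = C ε * (f * f.reflect c)) :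
    ε = -1 ∧ n = -(f.coeff 0 * f.coeff c) ∧
      (f.coeff 0 + f.coeff c) ^ 2 + ∑ i ∈ Finset.Ico 1 c, (f.coeff i) ^ 2 = 1 := by
  have h0 := congrArg (fun p => coeff p 0) h
  have h1 := congrArg (fun p => coeff p c) h
  have hc0 : c ≠ 0 := by omega
  have hc2 : c ≠ 2 * c := by omega
  have hsum : (f * f.reflect c).coeff c = ∑ i ∈ Finset.range (c + 1), (f.coeff i) ^ 2 := by
    rw [coeff_mul, Finset.Nat.sum_antidiagonal_eq_sum_range_succ_mk]
    refine Finset.sum_congr rfl fun i hi => ?_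
    have hi' : i ≤ c := by
      have := Finset.mem_range.mp hi
      omega
    simp only [coeff_reflect]
    rw [revAt_le (Nat.sub_le c i), Nat.sub_sub_self hi', sq]
  have hsplit : ∑ i ∈ Finset.range (c + 1), (f.coeff i) ^ 2
      = f.coeff 0 ^ 2 + ∑ i ∈ Finset.Ico 1 c, (f.coeff i) ^ 2 + f.coeff c ^ 2 := by
    rw [Finset.sum_range_succ, Finset.range_eq_Ico, Finset.sum_eq_sum_Ico_succ_bot (by omega)]
  have hz : (f * f.reflect c).coeff 0 = f.coeff 0 * f.coeff c := by
    rw [mul_coeff_zero, coeff_reflect, revAt_zero]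
  simp only [coeff_C_mul, coeff_add, coeff_sub, coeff_X_pow, coeff_C, hz, hc0, hc0.symm, hc2,
    if_true, if_false, show (0 : ℕ) ≠ 2 * c by omega] at h0
  simp only [coeff_C_mul, coeff_add, coeff_sub, coeff_X_pow, coeff_C, hsum, hsplit, hc0, hc2,
    if_true, if_false] at h1
  have hn : 0 ≤ ∑ i ∈ Finset.Ico 1 c, (f.coeff i) ^ 2 :=
    Finset.sum_nonneg fun i _ => sq_nonneg _
  rcases hε with rfl | rfl
  · exfalso
    nlinarith [sq_nonneg (f.coeff 0 + f.coeff c)]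
  · refine ⟨rfl, by linarith, by linarith⟩
end

section
/- Let r ≥ 1 and let v, w, x ∈ ℤ^r. Suppose that Σ_i v_i² = 2, Σ_i w_i² = 2, Σ_i v_i·w_i = 0, Σ_i v_i·x_i is odd, and Σ_i w_i·x_i is even. Then the supports of v and w are disjoint: for every index i, v_i = 0 or w_i = 0. -/
lemma norm_two_aux (r : ℕ) (u : Fin r → ℤ) (hu : ∑ i, (u i) ^ 2 = 2)
    (i j : Fin r) (hij : i ≠ j) (hi : u i ≠ 0) (hj : u j ≠ 0) (k : Fin r) :
    u k % 2 = if k = i ∨ k = j then 1 else 0 := by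
  have pos : ∀ a : Fin r, u a ≠ 0 → 1 ≤ (u a) ^ 2 := fun a ha => by
    have : 0 < (u a) ^ 2 := by positivity
    omega
  have h1 : (u i) ^ 2 + (u j) ^ 2 ≤ 2 := by
    rw [← hu, ← Finset.sum_pair (f := fun a => (u a) ^ 2) hij]
    exact Finset.sum_le_sum_of_subset_of_nonneg (Finset.subset_univ _)
      (fun a _ _ => sq_nonneg _)
  have odd1 : ∀ a : Fin r, (u a) ^ 2 = 1 → u a % 2 = 1 := fun a ha => by
    rcases (show u a = 1 ∨ u a = -1 from by simpa using ha) with h | h <;> rw [h] <;> rfl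
  have pi := pos i hi
  have pj := pos j hj
  by_cases hki : k = i
  · subst hki
    simpa using odd1 k (by omega)
  by_cases hkj : k = j
  · subst hkj
    simpa using odd1 k (by omega)
  have hk : u k = 0 := by
    by_contra hk
    have pk := pos k hk
    have h2 : (u k) ^ 2 + ((u i) ^ 2 + (u j) ^ 2) ≤ 2 := by
      rw [← hu, ← Finset.sum_pair (f := fun a => (u a) ^ 2) hij,
        ← Finset.sum_insert (f := fun a => (u a) ^ 2) (a := k) (by simp [hki, hkj])]
      exact Finset.sum_le_sum_of_subset_of_nonneg (Finset.subset_univ _)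
        (fun a _ _ => sq_nonneg _)
    omega
  simp [hki, hkj, hk]


/-- Claim 1 of Lemma 3.3 (lattice-theoretic content, in the standard positive
definite lattice `ℤ^r`): if `v` and `w` have square-norm `2`, are orthogonal,
and there is a vector `x` with `⟨v,x⟩` odd and `⟨w,x⟩` even, then `v` and `w`
have disjoint supports. -/
theorem norm_two_orthogonal_disjoint_support (r : ℕ) (hr : 1 ≤ r)
    (v w x : Fin r → ℤ)
    (hv : ∑ i, (v i) ^ 2 = 2) (hw : ∑ i, (w i) ^ 2 = 2)
    (hvw : ∑ i, v i * w i = 0)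
    (hvx : Odd (∑ i, v i * x i)) (hwx : Even (∑ i, w i * x i)) :
    ∀ i, v i = 0 ∨ w i = 0 := by
  intro i
  by_contra hcon
  push Not at hcon
  obtain ⟨hvi, hwi⟩ := hcon
  have hex : ∃ j, i ≠ j ∧ v j * w j ≠ 0 := by
    by_contra hno
    push Not at hno
    rw [Finset.sum_eq_single i (fun j _ hj => hno j (Ne.symm hj)) (by simp)] at hvw
    exact mul_ne_zero hvi hwi hvw
  obtain ⟨j, hij, hj⟩ := hex
  have hvj := left_ne_zero_of_mul hj
  have hwj := right_ne_zero_of_mul hj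
  have hdvd : (2 : ℤ) ∣ ∑ k, v k * x k - ∑ k, w k * x k := by
    rw [← Finset.sum_sub_distrib]
    refine Finset.dvd_sum fun k _ => ?_
    rw [← sub_mul]
    have a := norm_two_aux r v hv i j hij hvi hvj k
    have b := norm_two_aux r w hw i j hij hwi hwj k
    exact Dvd.dvd.mul_right (by omega) _
  rw [Int.odd_iff] at hvx
  rw [Int.even_iff] at hwx
  omega
end

section
/- Let m < 0 and n be integers with n ≥ −m + 2, let (l_j)_{j ∈ J} be a finitely supported family of integers indexed by a finite set J with |l_j| ≤ 1 for all j, and let j₀ ∈ J. If 2·l_{j₀} − n·Σ_{j ∈ J} l_j² = 2m, then Σ_{j ∈ J} l_j² = 1 and n + 2m = 2·l_{j₀}. -/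
/-- The arithmetic deduction from equation (1) in Lemma 3.3: if `m < 0`,
`n ≥ -m + 2`, the integers `l_j` (finitely many, indexed by a finite set `J`)
all satisfy `|l_j| ≤ 1`, and `2·l_{j₀} - n·Σ_j l_j² = 2m`, then `Σ_j l_j² = 1`
and `n + 2m = 2·l_{j₀}`. -/
theorem sum_sq_eq_one_of_diag_gram (m n : ℤ) (hm : m < 0) (hn : n ≥ -m + 2)
    {J : Type*} [Fintype J] (l : J → ℤ) (hl : ∀ j, |l j| ≤ 1) (j₀ : J)
    (h : 2 * l j₀ - n * ∑ j, (l j) ^ 2 = 2 * m) :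
    (∑ j, (l j) ^ 2 = 1) ∧ n + 2 * m = 2 * l j₀ := by
  have hS : (l j₀) ^ 2 ≤ ∑ j, (l j) ^ 2 :=
    Finset.single_le_sum (f := fun j => (l j) ^ 2) (fun j _ => sq_nonneg _) (Finset.mem_univ j₀)
  have h0 := abs_le.mp (hl j₀)
  generalize (∑ j, (l j) ^ 2) = S at *
  have hS0 : 0 ≤ S := le_trans (sq_nonneg _) hS
  have hS1 : S = 1 := by
    rcases lt_trichotomy S 1 with h1 | h1 | h1
    · have hz : S = 0 := by omega
      subst hz
      have : l j₀ = 0 := by nlinarith [sq_nonneg (l j₀)]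
      rw [this] at h
      omega
    · exact h1
    · have : n * 2 ≤ n * S := mul_le_mul_of_nonneg_left (by omega) (by omega)
      omega
  refine ⟨hS1, ?_⟩
  subst hS1
  omega
end
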